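/- Let 0 ≤ a < 1 < b ≤ ∞ and f ∈ F₁(a,b) be strictly convex in a neighborhood of 1 with z₀ + β − α in the interior of {f* < ∞}, where z₀ := f'_+(1). Let P be a probability measure on X and h, h̃ : X → ℝ be bounded measurable with α ≤ h, h̃ ≤ β. Then |Λ_f^P[h̃] − Λ_f^P[h]| ≤ (f*)'_+(z₀ + β − α) · ‖h̃ − h‖_{L¹(P)}. -/

import Mathlib

open MeasureTheory Set Filter Topology
open scoped ENNReal NNReal Classical

noncomputable section

/-- The interval `(a, b)` with `b` possibly infinite. -/
def Dom (a : ℝ) (b : EReal) : Set ℝ := {t : ℝ | a < t ∧ (t : EReal) < b}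

/-- Legendre transform of `f` on `(a,b)`, with values in `(-∞, ∞]` (modeled by `EReal`). -/
def fStar (f : ℝ → ℝ) (a : ℝ) (b : EReal) (z : ℝ) : EReal :=
  ⨆ t ∈ Dom a b, ((z * t - f t : ℝ) : EReal)

/-- Real-valued version of the Legendre transform (junk value where it is `⊤`). -/
def fStarR (f : ℝ → ℝ) (a : ℝ) (b : EReal) (z : ℝ) : ℝ := (fStar f a b z).toReal

/-- Right derivative of `g` at `z`. -/
def rderiv (g : ℝ → ℝ) (z : ℝ) : ℝ := derivWithin g (Ici z) z

/-- `z₀ := f'_+(1)`. -/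
def zz (f : ℝ → ℝ) : ℝ := rderiv f 1

/-- Integral of an `EReal`-valued function: the Bochner integral if the function is
a.e. finite and integrable, and `⊤` otherwise. -/
def eIntegral {X : Type*} [MeasurableSpace X] (P : Measure X) (g : X → EReal) : EReal :=
  if (∀ᵐ x ∂P, g x ≠ ⊤) ∧ Integrable (fun x => (g x).toReal) P
  then ((∫ x, (g x).toReal ∂P : ℝ) : EReal) else ⊤

/-- The generalized cumulant generating function `Λ_f^P[h]`. -/
def cgf {X : Type*} [MeasurableSpace X] (f : ℝ → ℝ) (a : ℝ) (b : EReal)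
    (P : Measure X) (h : X → ℝ) : EReal :=
  ⨅ ν : ℝ, ((ν : EReal) + eIntegral P (fun x => fStar f a b (h x - ν)))

/-- Real-valued `Λ_f^P[h]`. -/
def cgfR {X : Type*} [MeasurableSpace X] (f : ℝ → ℝ) (a : ℝ) (b : EReal)
    (P : Measure X) (h : X → ℝ) : ℝ := (cgf f a b P h).toReal

/-- `Λ_f : ℝⁿ → ℝ` (with values in `EReal`). -/
def lamVec (f : ℝ → ℝ) (a : ℝ) (b : EReal) {n : ℕ} (x : Fin n → ℝ) : EReal :=
  ⨅ ν : ℝ, ((ν : EReal) + ((n : ℝ)⁻¹ : EReal) * ∑ i, fStar f a b (x i - ν))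

/-- Empirical measure of `n` points. -/
def empMeas {X : Type*} [MeasurableSpace X] (n : ℕ) (xs : Fin n → X) : Measure X :=
  (n : ℝ≥0∞)⁻¹ • ∑ i, Measure.dirac (xs i)

/-- The `(f,Γ)`-divergence `D_f^Γ(Q‖P)`. -/
def Dfg {X : Type*} [MeasurableSpace X] (f : ℝ → ℝ) (a : ℝ) (b : EReal)
    (Γ : Set (X → ℝ)) (Q P : Measure X) : ℝ :=
  sSup {r : ℝ | ∃ h ∈ Γ, r = ∫ x, h x ∂Q - cgfR f a b P h}

/-- Empirical Rademacher complexity of `Ψ` at the sample `y`. -/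
def empRad {Y : Type*} (Ψ : Set (Y → ℝ)) (n : ℕ) (y : Fin n → Y) : ℝ :=
  (2 ^ n : ℝ)⁻¹ * ∑ σ : Fin n → Bool,
    sSup {r : ℝ | ∃ ψ ∈ Ψ, r = (n : ℝ)⁻¹ * ∑ i, (if σ i then 1 else -1) * ψ (y i)}

/-- Rademacher complexity of `Ψ` relative to `P` with `n` samples. -/
def rad {Y : Type*} [MeasurableSpace Y] (Ψ : Set (Y → ℝ)) (P : Measure Y) (n : ℕ) : ℝ :=
  ∫ y, empRad Ψ n y ∂(Measure.pi fun _ : Fin n => P)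

/-- `Δ_{f,n}`. -/
def Δq (f : ℝ → ℝ) (a : ℝ) (b : EReal) (α β : ℝ) (n : ℕ) : ℝ :=
  sInf ((fun z => (n : ℝ) * (-z + (((n : ℝ) - 1) / (n : ℝ)) * fStarR f a b z
      + (1 / (n : ℝ)) * fStarR f a b (β - α + z))) '' Icc (zz f - (β - α)) (zz f))

/-- `sup_{h ∈ Γ} inf_{h̃ ∈ Γ̃} ‖h − h̃‖_∞`. -/
def approxErr {X : Type*} (Γ Γt : Set (X → ℝ)) : ℝ :=
  sSup {r : ℝ | ∃ h ∈ Γ, r = sInf {s : ℝ | ∃ ht ∈ Γt, s = ⨆ x, |h x - ht x|}}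

/-- A countable subset which is pointwise-limit dense. -/
def PtwiseDenseCount {X : Type*} (Γ : Set (X → ℝ)) : Prop :=
  ∃ Γ₀ ⊆ Γ, Γ₀.Countable ∧ ∀ h ∈ Γ, ∃ s : ℕ → X → ℝ,
    (∀ j, s j ∈ Γ₀) ∧ ∀ x, Tendsto (fun j => s j x) atTop (𝓝 (h x))

/-- The quantity `K_{f,Ψ,P,n}` from Definition 3.4: either `(f*)'_+` is Lipschitz on the
relevant interval and `Ψ` contains a constant, in which case `K` is the minimum of the two
expressions, or `K` is the second expression. -/
def Kchoice (f : ℝ → ℝ) (a : ℝ) (b : EReal) (α β : ℝ) {Y : Type*} [MeasurableSpace Y]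
    (Ψ : Set (Y → ℝ)) (P : Measure Y) (n : ℕ) (K : ℝ) : Prop :=
  (∃ L : ℝ≥0, LipschitzOnWith L (rderiv (fStarR f a b))
      (Icc (zz f - (β - α)) (zz f + (β - α))) ∧
    (∃ c : ℝ, (fun _ => c) ∈ Ψ) ∧
    K = min ((1 + 2 * (β - α) * (L : ℝ)) * rad Ψ P n
        + (β - α) ^ 2 * (L : ℝ) / (2 * Real.sqrt n))
      (rderiv (fStarR f a b) (β - α + zz f) * (rad Ψ P n + (β - α) / (2 * Real.sqrt n))))
  ∨ K = rderiv (fStarR f a b) (β - α + zz f) * (rad Ψ P n + (β - α) / (2 * Real.sqrt n))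

/-- Covering number of a (pseudo)metric space by `ε`-balls. -/
def coverNum (Θ : Type*) [PseudoMetricSpace Θ] (ε : ℝ) : ℝ≥0∞ :=
  ⨅ s ∈ {s : Finset Θ | ∀ θ : Θ, ∃ c ∈ s, dist θ c ≤ ε}, ((s.card : ℝ≥0∞))

end

/-- The right derivative of a convex function is a subgradient at interior points. -/
lemma ConvexOn.rderiv_mul_sub_le {S : Set ℝ} {g : ℝ → ℝ} (hg : ConvexOn ℝ S g) {x y : ℝ}
    (hy : y ∈ interior S) (hx : x ∈ S) : rderiv g y * (x - y) ≤ g x - g y := by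
  unfold rderiv
  rw [← derivWithin_Ioi_eq_Ici]
  rcases lt_trichotomy x y with hxy | rfl | hxy
  · have h1 := (hg.slope_le_leftDeriv_of_mem_interior hx hy hxy).trans
      (hg.leftDeriv_le_rightDeriv_of_mem_interior hy)
    rw [slope_def_field, div_le_iff₀ (by linarith)] at h1
    linarith
  · simp
  · have h1 := hg.rightDeriv_le_slope_of_mem_interior hy hx hxy
    rw [slope_def_field, le_div_iff₀ (by linarith)] at h1
    linarith

section LegendreTransform

variable {f : ℝ → ℝ} {a : ℝ} {b : EReal} {z z' c : ℝ}

lemma fStar_le_coe_iff :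
    fStar f a b z ≤ (c : EReal) ↔ ∀ t ∈ Dom a b, z * t - f t ≤ c := by
  simp only [fStar, iSup_le_iff, EReal.coe_le_coe_iff]

lemma coe_le_fStar {t : ℝ} (ht : t ∈ Dom a b) :
    ((z * t - f t : ℝ) : EReal) ≤ fStar f a b z :=
  le_iSup₂_of_le t ht le_rfl

lemma fStar_ne_bot (h1 : 1 ∈ Dom a b) : fStar f a b z ≠ ⊥ :=
  ((EReal.bot_lt_coe _).trans_le (coe_le_fStar h1)).ne'

lemma coe_fStarR (h1 : 1 ∈ Dom a b) (hz : fStar f a b z < ⊤) :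
    (fStarR f a b z : EReal) = fStar f a b z :=
  EReal.coe_toReal hz.ne (fStar_ne_bot h1)

lemma fStarR_le_iff (h1 : 1 ∈ Dom a b) (hz : fStar f a b z < ⊤) :
    fStarR f a b z ≤ c ↔ ∀ t ∈ Dom a b, z * t - f t ≤ c := by
  rw [← fStar_le_coe_iff, ← coe_fStarR h1 hz, EReal.coe_le_coe_iff]

lemma le_fStarR (h1 : 1 ∈ Dom a b) (hz : fStar f a b z < ⊤) {t : ℝ} (ht : t ∈ Dom a b) :
    z * t - f t ≤ fStarR f a b z :=
  (fStarR_le_iff h1 hz).1 le_rfl t ht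

lemma self_le_fStarR (h1 : 1 ∈ Dom a b) (hf1 : f 1 = 0) (hz : fStar f a b z < ⊤) :
    z ≤ fStarR f a b z := by
  simpa [hf1] using le_fStarR h1 hz h1

lemma fStar_mono (ha : 0 ≤ a) : Monotone (fStar f a b) := by
  intro z w hzw
  refine iSup₂_mono fun t ht => ?_
  rw [EReal.coe_le_coe_iff]
  have := mul_le_mul_of_nonneg_right hzw (ha.trans ht.1.le)
  linarith

lemma fStarR_monotoneOn (ha : 0 ≤ a) (h1 : 1 ∈ Dom a b) :
    MonotoneOn (fStarR f a b) {z | fStar f a b z < ⊤} := fun _ _ _ hw hzw =>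
  EReal.toReal_le_toReal (fStar_mono ha hzw) (fStar_ne_bot h1) (ne_of_lt hw)

lemma fStarR_convexOn (ha : 0 ≤ a) (h1 : 1 ∈ Dom a b) :
    ConvexOn ℝ {z | fStar f a b z < ⊤} (fStarR f a b) := by
  have hlower : IsLowerSet {z | fStar f a b z < ⊤} := fun x y hyx hx =>
    (fStar_mono ha hyx).trans_lt hx
  have hS : Convex ℝ {z | fStar f a b z < ⊤} := hlower.ordConnected.convex
  refine ⟨hS, fun x hx y hy p q hp hq hpq => ?_⟩
  refine (fStarR_le_iff h1 (hS hx hy hp hq hpq)).2 fun t ht => ?_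
  have hxt := mul_le_mul_of_nonneg_left (le_fStarR h1 hx ht) hp
  have hyt := mul_le_mul_of_nonneg_left (le_fStarR h1 hy ht) hq
  have hft : f t = p * f t + q * f t := by rw [← add_mul, hpq, one_mul]
  simp only [smul_eq_mul]
  linarith

lemma Iic_subset_interior_fStar_lt_top (ha : 0 ≤ a)
    (hz : z ∈ interior {z | fStar f a b z < ⊤}) :
    Iic z ⊆ interior {z | fStar f a b z < ⊤} := by
  have hev : ∀ᶠ w in 𝓝[>] z, fStar f a b w < ⊤ :=
    nhdsWithin_le_nhds (mem_interior_iff_mem_nhds.1 hz)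
  obtain ⟨w, hw, hzw⟩ := (hev.and self_mem_nhdsWithin).exists
  have hsub : Iio w ⊆ {z | fStar f a b z < ⊤} := fun x hx =>
    (fStar_mono ha (le_of_lt hx)).trans_lt hw
  exact fun x hx => interior_maximal hsub isOpen_Iio (lt_of_le_of_lt hx hzw)

lemma abs_fStarR_sub_le (ha : 0 ≤ a) (h1 : 1 ∈ Dom a b) {x y : ℝ}
    (hz : z ∈ interior {z | fStar f a b z < ⊤}) (hx : x ≤ z) (hy : y ≤ z) :
    |fStarR f a b x - fStarR f a b y| ≤ rderiv (fStarR f a b) z * |x - y| := by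
  wlog hxy : y ≤ x generalizing x y
  · rw [abs_sub_comm, abs_sub_comm x]
    exact this hy hx (le_of_not_ge hxy)
  have hconv := fStarR_convexOn (f := f) ha h1
  have hxi := Iic_subset_interior_fStar_lt_top ha hz hx
  have hyi := Iic_subset_interior_fStar_lt_top ha hz hy
  rw [abs_of_nonneg (sub_nonneg.2 hxy), abs_of_nonneg (sub_nonneg.2
    (fStarR_monotoneOn ha h1 (interior_subset hyi) (interior_subset hxi) hxy))]
  have hsub := hconv.rderiv_mul_sub_le hxi (interior_subset hyi)
  have hmono : rderiv (fStarR f a b) x ≤ rderiv (fStarR f a b) z := by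
    unfold rderiv
    simp only [← derivWithin_Ioi_eq_Ici]
    exact hconv.monotoneOn_rightDeriv hxi hz hx
  have := mul_le_mul_of_nonneg_right hmono (sub_nonneg.2 hxy)
  linarith

/-- If `s` is a subgradient of `f` at `1`, then `z ↦ f*(z) - z` decreases up to `s` and increases
from `s` on. -/
lemma fStarR_add_sub_le {s : ℝ} (h1 : 1 ∈ Dom a b) (hf1 : f 1 = 0)
    (hs : ∀ t ∈ Dom a b, s * (t - 1) ≤ f t)
    (hz : fStar f a b z < ⊤) (hz' : fStar f a b z' < ⊤)
    (hzz' : s ≤ z' ∧ z' ≤ z ∨ z' ≤ s ∧ z ≤ z') :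
    fStarR f a b z' + (z - z') ≤ fStarR f a b z := by
  rw [← le_sub_iff_add_le, fStarR_le_iff h1 hz']
  intro t ht
  have hst := hs t ht
  have hzt := le_fStarR h1 hz ht
  have hz1 := self_le_fStarR h1 hf1 hz
  rcases hzz' with ⟨h₁, h₂⟩ | ⟨h₁, h₂⟩ <;> rcases le_total t 1 with h₃ | h₃ <;>
    nlinarith [mul_nonneg (sub_nonneg.2 h₁) (sub_nonneg.2 h₃),
      mul_nonneg (sub_nonneg.2 h₂) (sub_nonneg.2 h₃)]

end LegendreTransform

section CumulantGeneratingFunction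

variable {X : Type*} [MeasurableSpace X] {P : Measure X} {f : ℝ → ℝ} {a : ℝ} {b : EReal}

lemma integrable_fStarR_sub [IsFiniteMeasure P] {α β ν : ℝ} {h : X → ℝ} (ha : 0 ≤ a)
    (h1 : 1 ∈ Dom a b) (hfin : fStar f a b (β - ν) < ⊤) (hmeas : Measurable h)
    (hbd : ∀ x, h x ∈ Icc α β) : Integrable (fun x => fStarR f a b (h x - ν)) P := by
  have hlt : ∀ z ≤ β - ν, fStar f a b z < ⊤ := fun z hz => (fStar_mono ha hz).trans_lt hfin
  have hmono := fStarR_monotoneOn (f := f) ha h1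
  have hG : Monotone fun z => fStarR f a b (min z (β - ν)) := fun z w hzw =>
    hmono (hlt _ (min_le_right _ _)) (hlt _ (min_le_right _ _)) (min_le_min_right _ hzw)
  have hle : ∀ x, h x - ν ≤ β - ν := fun x => by linarith [(hbd x).2]
  have heq : (fun x => fStarR f a b (h x - ν))
      = fun x => fStarR f a b (min (h x - ν) (β - ν)) := by
    funext x
    rw [min_eq_left (hle x)]
  refine Integrable.of_mem_Icc (fStarR f a b (α - ν)) (fStarR f a b (β - ν)) ?_
    (Eventually.of_forall fun x => ?_)
  · rw [heq]
    exact (hG.measurable.comp (hmeas.sub_const ν)).aemeasurable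
  · have hα : α - ν ≤ h x - ν := by linarith [(hbd x).1]
    exact ⟨hmono (hlt _ (hα.trans (hle x))) (hlt _ (hle x)) hα,
      hmono (hlt _ (hle x)) hfin (hle x)⟩

lemma eIntegral_fStar_sub [IsFiniteMeasure P] {α β ν : ℝ} {h : X → ℝ} (ha : 0 ≤ a)
    (h1 : 1 ∈ Dom a b) (hfin : fStar f a b (β - ν) < ⊤) (hmeas : Measurable h)
    (hbd : ∀ x, h x ∈ Icc α β) :
    eIntegral P (fun x => fStar f a b (h x - ν))
      = ((∫ x, fStarR f a b (h x - ν) ∂P : ℝ) : EReal) := by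
  refine if_pos ⟨Eventually.of_forall fun x => ?_,
    integrable_fStarR_sub ha h1 hfin hmeas hbd⟩
  exact ((fStar_mono ha (by linarith [(hbd x).2])).trans_lt hfin).ne

/-- Only the shifts `ν ∈ [α - s, β - s]` matter in the infimum defining `cgf`, where `s` is a
subgradient of `f` at `1`. -/
lemma exists_mem_Icc_add_integral_le [IsProbabilityMeasure P] {α β s : ℝ} {h : X → ℝ}
    (ha : 0 ≤ a) (h1 : 1 ∈ Dom a b) (hf1 : f 1 = 0) (hs : ∀ t ∈ Dom a b, s * (t - 1) ≤ f t)
    (hfin : fStar f a b (s + β - α) < ⊤) (hαβ : α ≤ β) (hmeas : Measurable h)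
    (hbd : ∀ x, h x ∈ Icc α β) (ν : ℝ) :
    ∃ ν₀ ∈ Icc (α - s) (β - s), ((ν₀ + ∫ x, fStarR f a b (h x - ν₀) ∂P : ℝ) : EReal)
      ≤ (ν : EReal) + eIntegral P (fun x => fStar f a b (h x - ν)) := by
  by_cases hc : (∀ᵐ x ∂P, fStar f a b (h x - ν) ≠ ⊤) ∧
      Integrable (fun x => (fStar f a b (h x - ν)).toReal) P
  swap
  · refine ⟨α - s, ⟨le_rfl, by linarith⟩, ?_⟩
    rw [eIntegral, if_neg hc, EReal.coe_add_top]
    exact le_top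
  rw [eIntegral, if_pos hc]
  have hlt : ∀ ν₀ ∈ Icc (α - s) (β - s), fStar f a b (β - ν₀) < ⊤ := fun ν₀ hν₀ =>
    (fStar_mono ha (by linarith [hν₀.1])).trans_lt hfin
  obtain ⟨ν₀, hν₀, hcase⟩ : ∃ ν₀ ∈ Icc (α - s) (β - s),
      ν₀ = ν ∨ (ν₀ = α - s ∧ ν ≤ ν₀) ∨ (ν₀ = β - s ∧ ν₀ ≤ ν) := by
    rcases le_total ν (α - s) with hν | hν
    · exact ⟨α - s, ⟨le_rfl, by linarith⟩, Or.inr (Or.inl ⟨rfl, hν⟩)⟩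
    rcases le_total ν (β - s) with hν' | hν'
    · exact ⟨ν, ⟨hν, hν'⟩, Or.inl rfl⟩
    · exact ⟨β - s, ⟨by linarith, le_rfl⟩, Or.inr (Or.inr ⟨rfl, hν'⟩)⟩
  refine ⟨ν₀, hν₀, ?_⟩
  have hint := integrable_fStarR_sub (P := P) ha h1 (hlt ν₀ hν₀) hmeas hbd
  have hmono : ∫ x, (fStarR f a b (h x - ν₀) + (ν₀ - ν)) ∂P
      ≤ ∫ x, (fStar f a b (h x - ν)).toReal ∂P := by
    refine integral_mono_ae (hint.add (integrable_const _)) hc.2 ?_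
    filter_upwards [hc.1] with x hx
    have hx₀ : fStar f a b (h x - ν₀) < ⊤ :=
      (fStar_mono ha (by linarith [(hbd x).2])).trans_lt (hlt ν₀ hν₀)
    rcases hcase with rfl | hcase
    · simp [fStarR]
    have := fStarR_add_sub_le (s := s) h1 hf1 hs (lt_top_iff_ne_top.2 hx) hx₀ (by
      rcases hcase with ⟨h₁, h₂⟩ | ⟨h₁, h₂⟩
      · exact Or.inl ⟨by linarith [(hbd x).1], by linarith⟩
      · exact Or.inr ⟨by linarith [(hbd x).2], by linarith⟩)
    unfold fStarR at this ⊢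
    linarith
  rw [integral_add hint (integrable_const _), integral_const, probReal_univ, one_smul] at hmono
  rw [← EReal.coe_add, EReal.coe_le_coe_iff]
  linarith

lemma coe_cgfR [IsProbabilityMeasure P] {α β s : ℝ} {h : X → ℝ}
    (ha : 0 ≤ a) (h1 : 1 ∈ Dom a b) (hf1 : f 1 = 0) (hs : ∀ t ∈ Dom a b, s * (t - 1) ≤ f t)
    (hfin : fStar f a b (s + β - α) < ⊤) (hαβ : α ≤ β) (hmeas : Measurable h)
    (hbd : ∀ x, h x ∈ Icc α β) : (cgfR f a b P h : EReal) = cgf f a b P h := by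
  have hlt : ∀ ν₀ ∈ Icc (α - s) (β - s), fStar f a b (β - ν₀) < ⊤ := fun ν₀ hν₀ =>
    (fStar_mono ha (by linarith [hν₀.1])).trans_lt hfin
  refine EReal.coe_toReal (ne_of_lt ?_) (ne_of_gt ?_)
  · refine (iInf_le _ (α - s)).trans_lt ?_
    rw [eIntegral_fStar_sub ha h1 (hlt _ ⟨le_rfl, by linarith⟩) hmeas hbd, ← EReal.coe_add]
    exact EReal.coe_lt_top _
  · refine (EReal.bot_lt_coe α).trans_le (le_iInf fun ν => ?_)
    obtain ⟨ν₀, hν₀, hle⟩ := exists_mem_Icc_add_integral_le (P := P) ha h1 hf1 hs hfin hαβ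
      hmeas hbd ν
    refine le_trans ?_ hle
    rw [EReal.coe_le_coe_iff]
    have hmono : ∫ _, (α - ν₀) ∂P ≤ ∫ x, fStarR f a b (h x - ν₀) ∂P := by
      refine integral_mono (integrable_const _)
        (integrable_fStarR_sub ha h1 (hlt ν₀ hν₀) hmeas hbd) fun x => ?_
      have := self_le_fStarR h1 hf1
        ((fStar_mono ha (sub_le_sub_right (hbd x).2 ν₀)).trans_lt (hlt ν₀ hν₀))
      linarith [(hbd x).1]
    rw [integral_const, probReal_univ, one_smul] at hmono
    linarith

lemma cgfR_le_add [IsProbabilityMeasure P] {α β s : ℝ} {h k : X → ℝ}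
    (ha : 0 ≤ a) (h1 : 1 ∈ Dom a b) (hf1 : f 1 = 0) (hs : ∀ t ∈ Dom a b, s * (t - 1) ≤ f t)
    (hz : s + β - α ∈ interior {z | fStar f a b z < ⊤}) (hαβ : α ≤ β)
    (hmeas : Measurable h) (kmeas : Measurable k)
    (hbd : ∀ x, h x ∈ Icc α β) (kbd : ∀ x, k x ∈ Icc α β) :
    cgfR f a b P k
      ≤ cgfR f a b P h + rderiv (fStarR f a b) (s + β - α) * ∫ x, |k x - h x| ∂P := by
  have hfin : fStar f a b (s + β - α) < ⊤ :=
    interior_subset (s := {z | fStar f a b z < ⊤}) hz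
  rw [← sub_le_iff_le_add, ← EReal.coe_le_coe_iff,
    coe_cgfR (h := h) ha h1 hf1 hs hfin hαβ hmeas hbd]
  refine le_iInf fun ν => ?_
  obtain ⟨ν₀, hν₀, hle⟩ := exists_mem_Icc_add_integral_le (P := P) ha h1 hf1 hs hfin hαβ
    hmeas hbd ν
  refine le_trans ?_ hle
  rw [EReal.coe_le_coe_iff]
  have hlt : fStar f a b (β - ν₀) < ⊤ :=
    (fStar_mono ha (by linarith [hν₀.1])).trans_lt hfin
  have hk : cgfR f a b P k ≤ ν₀ + ∫ x, fStarR f a b (k x - ν₀) ∂P := by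
    rw [← EReal.coe_le_coe_iff, coe_cgfR ha h1 hf1 hs hfin hαβ kmeas kbd, EReal.coe_add,
      ← eIntegral_fStar_sub ha h1 hlt kmeas kbd]
    exact iInf_le _ ν₀
  have hih := integrable_fStarR_sub (P := P) ha h1 hlt hmeas hbd
  have hik := integrable_fStarR_sub (P := P) ha h1 hlt kmeas kbd
  have hid : Integrable (fun x => |k x - h x|) P :=
    ((Integrable.of_mem_Icc α β kmeas.aemeasurable (Eventually.of_forall kbd)).sub
      (Integrable.of_mem_Icc α β hmeas.aemeasurable (Eventually.of_forall hbd))).abs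
  have hdiff : ∫ x, (fStarR f a b (k x - ν₀) - fStarR f a b (h x - ν₀)) ∂P
      ≤ ∫ x, rderiv (fStarR f a b) (s + β - α) * |k x - h x| ∂P := by
    refine integral_mono (hik.sub hih) (hid.const_mul _) fun x => ?_
    refine (le_abs_self _).trans ((abs_fStarR_sub_le ha h1 hz ?_ ?_).trans_eq ?_)
    · linarith [(kbd x).2, hν₀.1]
    · linarith [(hbd x).2, hν₀.1]
    · rw [sub_sub_sub_cancel_right]
  rw [integral_sub hik hih, integral_const_mul] at hdiff
  linarith

end CumulantGeneratingFunction

/-- Lipschitz bound for the generalized cumulant generating function. -/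
theorem stmt2 {X : Type*} [MeasurableSpace X]
    (f : ℝ → ℝ) (a : ℝ) (b : EReal) (α β : ℝ)
    (ha0 : 0 ≤ a) (ha1 : a < 1) (hb1 : ((1 : ℝ) : EReal) < b)
    (hconv : ConvexOn ℝ (Dom a b) f) (hf1 : f 1 = 0)
    (hstrict : ∃ ε > 0, Set.Ioo (1 - ε) (1 + ε) ⊆ Dom a b ∧
      StrictConvexOn ℝ (Set.Ioo (1 - ε) (1 + ε)) f)
    (hz : zz f + β - α ∈ interior {z : ℝ | fStar f a b z < ⊤})
    (P : MeasureTheory.Measure X) [MeasureTheory.IsProbabilityMeasure P]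
    (h ht : X → ℝ) (hmeas : Measurable h) (htmeas : Measurable ht)
    (hbd : ∀ x, h x ∈ Set.Icc α β) (htbd : ∀ x, ht x ∈ Set.Icc α β) :
    |cgfR f a b P ht - cgfR f a b P h| ≤
      rderiv (fStarR f a b) (zz f + β - α) * ∫ x, |ht x - h x| ∂P := by
  have h1 : (1 : ℝ) ∈ Dom a b := ⟨ha1, hb1⟩
  have h1i : (1 : ℝ) ∈ interior (Dom a b) := by
    obtain ⟨ε, hε, hsub, -⟩ := hstrict
    exact interior_maximal hsub isOpen_Ioo ⟨by linarith, by linarith⟩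
  have hs : ∀ t ∈ Dom a b, zz f * (t - 1) ≤ f t := fun t ht => by
    simpa [hf1, zz] using hconv.rderiv_mul_sub_le h1i ht
  obtain ⟨x₀⟩ : Nonempty X := nonempty_of_isProbabilityMeasure P
  have hαβ : α ≤ β := (hbd x₀).1.trans (hbd x₀).2
  have hle := cgfR_le_add (P := P) ha0 h1 hf1 hs hz hαβ hmeas htmeas hbd htbd
  have hge := cgfR_le_add (P := P) ha0 h1 hf1 hs hz hαβ htmeas hmeas htbd hbd
  simp only [abs_sub_comm (h _)] at hge
  rw [abs_sub_le_iff]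
  exact ⟨by linarith, by linarith⟩
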